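/- Let n ≥ 3 and let x be an integer with 1 < x < n. If n ≡ 1 (mod 3) and x ≡ 1 (mod 3), then the 5-regular circulant graph C_{2n}(x,1,n) is word-representable. -/

import Mathlib

/-- Two letters `x` and `y` alternate in the word `w` if, after deleting all letters
other than `x` and `y`, no two consecutive letters of the resulting word are equal. -/
def Alternate {V : Type*} [DecidableEq V] (w : List V) (x y : V) : Prop :=
  (w.filter (fun z => decide (z = x ∨ z = y))).Chain' (· ≠ ·)

/-- A word `w` represents the graph `G` if it contains every vertex at least once and
two distinct vertices are adjacent in `G` iff they alternate in `w`. -/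
def Represents {V : Type*} [DecidableEq V] (G : SimpleGraph V) (w : List V) : Prop :=
  (∀ v : V, v ∈ w) ∧ ∀ x y : V, x ≠ y → (G.Adj x y ↔ Alternate w x y)

/-- A graph is word-representable if some word represents it. -/
def WordRepresentable {V : Type*} [DecidableEq V] (G : SimpleGraph V) : Prop :=
  ∃ w : List V, Represents G w

/-- A word is `k`-uniform if every letter of the alphabet occurs in it exactly `k` times. -/
def IsKUniform {V : Type*} [DecidableEq V] (w : List V) (k : ℕ) : Prop :=
  ∀ v : V, w.count v = k

theorem isChain_ne_flatten_replicate_pair {V : Type*} {u v : V} (h : u ≠ v) (k : ℕ) :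
    ((List.replicate k [u, v]).flatten).IsChain (· ≠ ·) := by
  induction k with
  | zero => simp
  | succ k ih =>
    cases k with
    | zero => simp [h]
    | succ k =>
      simp only [List.replicate_succ, List.flatten_cons, List.cons_append, List.nil_append] at ih ⊢
      simp only [List.isChain_cons_cons] at ih ⊢
      exact ⟨h, h.symm, ih⟩

section ThreeColorable

variable {V : Type*} [DecidableEq V]

/-- Every edge `u v` with `c u < c v` restricts `w` to a power of the word `u v`. -/
def AlternatesAlong (G : SimpleGraph V) (c : V → Fin 3) (w : List V) : Prop :=
  ∀ u v, G.Adj u v → c u < c v →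
    ∃ k, w.filter (fun z => decide (z = u ∨ z = v)) = (List.replicate k [u, v]).flatten

theorem alternate_iff_isChain {w : List V} {a b : V} :
    Alternate w a b ↔ (w.filter (fun z => decide (z = a ∨ z = b))).IsChain (· ≠ ·) :=
  Iff.rfl

theorem Alternate.symm {w : List V} {a b : V} (h : Alternate w a b) : Alternate w b a := by
  simpa only [Alternate, or_comm] using h

theorem Alternate.of_infix {w w' : List V} {a b : V} (h : Alternate w a b) (hw : w' <:+: w) :
    Alternate w' a b :=
  List.IsChain.infix h (hw.filter _)

namespace AlternatesAlong

variable {G : SimpleGraph V} {c : V → Fin 3}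

theorem nil : AlternatesAlong G c [] := fun _ _ _ _ => ⟨0, by simp⟩

theorem append {w w' : List V} (h : AlternatesAlong G c w) (h' : AlternatesAlong G c w') :
    AlternatesAlong G c (w ++ w') := by
  intro u v huv hc
  obtain ⟨k, hk⟩ := h u v huv hc
  obtain ⟨l, hl⟩ := h' u v huv hc
  exact ⟨k + l, by rw [List.filter_append, hk, hl, List.replicate_add, List.flatten_append]⟩

theorem flatten {L : List (List V)} (h : ∀ w ∈ L, AlternatesAlong G c w) :
    AlternatesAlong G c L.flatten := by
  induction L with
  | nil => exact nil
  | cons w L ih =>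
    rw [List.flatten_cons]
    exact (h w (by simp)).append (ih fun w' hw' => h w' (by simp [hw']))

theorem alternate {w : List V} (h : AlternatesAlong G c w) (hc : ∀ u v, G.Adj u v → c u ≠ c v)
    {u v : V} (huv : G.Adj u v) : Alternate w u v := by
  have key : ∀ u v, G.Adj u v → c u < c v → Alternate w u v := by
    intro u v huv hlt
    obtain ⟨k, hk⟩ := h u v huv hlt
    unfold Alternate
    rw [hk]
    exact isChain_ne_flatten_replicate_pair huv.ne k
  rcases lt_or_gt_of_ne (hc u v huv) with hlt | hlt
  · exact key u v huv hlt
  · exact (key v u huv.symm hlt).symm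

end AlternatesAlong

variable [Fintype V]

/-- The word listing once each letter that satisfies `p`. -/
noncomputable def listing (p : V → Prop) [DecidablePred p] : List V :=
  Finset.univ.toList.filter (fun z => decide (p z))

theorem filter_listing (p : V → Prop) [DecidablePred p] {u v : V}
    (h : ¬(p u ∧ p v)) :
    (listing p).filter (fun z => decide (z = u) || decide (z = v)) =
      if p u then [u] else if p v then [v] else [] := by
  have single : ∀ t : V, Finset.univ.toList.filter (fun z => decide (z = t)) = [t] := by
    intro t
    rw [← List.perm_singleton, List.perm_iff_count]
    intro a
    by_cases ha : a = t
    · subst ha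
      rw [List.count_filter (by simp), List.count_eq_one_of_mem (Finset.nodup_toList _) (by simp)]
      simp
    · rw [List.count_eq_zero_of_not_mem (by simp [ha]), List.count_eq_zero_of_not_mem (by simp [ha])]
  unfold listing
  rw [List.filter_filter]
  split_ifs with h1 h2
  · rw [← single u]
    refine List.filter_congr fun z _ => ?_
    grind
  · rw [← single v]
    refine List.filter_congr fun z _ => ?_
    grind
  · rw [List.filter_eq_nil_iff]
    grind

theorem wordRepresentable_of_separating {G : SimpleGraph V} {c : V → Fin 3}
    (hc : ∀ u v, G.Adj u v → c u ≠ c v) {w₀ : List V} (hw₀ : AlternatesAlong G c w₀)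
    (hmem : ∀ v, v ∈ w₀)
    (hsep : ∀ a b, a ≠ b → ¬G.Adj a b → ∃ w, AlternatesAlong G c w ∧ ¬Alternate w a b) :
    WordRepresentable G := by
  classical
  have hsep' : ∀ q : V × V, ∃ w, AlternatesAlong G c w ∧
      (q.1 ≠ q.2 → ¬G.Adj q.1 q.2 → ¬Alternate w q.1 q.2) := by
    intro q
    by_cases hq : q.1 ≠ q.2 ∧ ¬G.Adj q.1 q.2
    · obtain ⟨w, hw, hn⟩ := hsep q.1 q.2 hq.1 hq.2
      exact ⟨w, hw, fun _ _ => hn⟩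
    · exact ⟨[], AlternatesAlong.nil, fun h1 h2 => absurd ⟨h1, h2⟩ hq⟩
  choose f hf hfn using hsep'
  have hall : AlternatesAlong G c (w₀ ++ (Finset.univ.toList.map f).flatten) := by
    refine hw₀.append (AlternatesAlong.flatten fun w hw => ?_)
    obtain ⟨q, -, rfl⟩ := List.mem_map.1 hw
    exact hf q
  refine ⟨_, fun v => List.mem_append_left _ (hmem v), fun a b hab => ⟨hall.alternate hc, ?_⟩⟩
  intro halt
  by_contra hadj
  refine hfn (a, b) hab hadj (halt.of_infix ?_)
  refine List.IsInfix.trans ?_ (List.suffix_append _ _).isInfix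
  exact List.infix_of_mem_flatten (List.mem_map_of_mem (by simp))

/-- Every finite 3-colourable graph is word-representable. -/
theorem wordRepresentable_of_three_coloring (G : SimpleGraph V) (c : V → Fin 3)
    (hc : ∀ u v, G.Adj u v → c u ≠ c v) : WordRepresentable G := by
  have fin3 : ∀ i : Fin 3, i = 0 ∨ i = 1 ∨ i = 2 := by decide
  have lt3 : ∀ i j : Fin 3, i < j → i = 0 ∧ j = 1 ∨ i = 0 ∧ j = 2 ∨ i = 1 ∧ j = 2 := by decide
  have hbase : AlternatesAlong G c (listing (fun z => c z = 0) ++ listing (fun z => c z = 1) ++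
      listing (fun z => c z = 2)) := by
    intro u v huv hlt
    refine ⟨1, ?_⟩
    rcases lt3 _ _ hlt with ⟨hu, hv⟩ | ⟨hu, hv⟩ | ⟨hu, hv⟩ <;>
      simp [filter_listing, hu, hv]
  refine wordRepresentable_of_separating hc hbase ?_ ?_
  · intro v
    rcases fin3 (c v) with h | h | h <;> simp [listing, h]
  have hsep : ∀ a b, c a < c b → ¬G.Adj a b →
      ∃ w, AlternatesAlong G c w ∧ ¬Alternate w a b := by
    intro a b hab hadj
    have hne : a ≠ b := fun h => hab.ne (congrArg c h)
    rcases lt3 _ _ hab with ⟨ha, hb⟩ | ⟨ha, hb⟩ | ⟨ha, hb⟩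
    · refine ⟨_, hbase.append (w' := listing (fun z => c z = 0 ∧ z ≠ a) ++
        listing (fun z => z = b) ++ listing (fun z => z = a) ++
        listing (fun z => c z = 1 ∧ z ≠ b) ++ listing (fun z => c z = 2)) ?_, ?_⟩
      · intro u v huv hlt
        refine ⟨1, ?_⟩
        rcases lt3 _ _ hlt with ⟨hu, hv⟩ | ⟨hu, hv⟩ | ⟨hu, hv⟩ <;>
          by_cases hua : u = a <;> by_cases hub : u = b <;>
          by_cases hva : v = a <;> by_cases hvb : v = b <;>
          simp_all [filter_listing, List.replicate]
      · simp [alternate_iff_isChain, filter_listing, ha, hb, hne, hne.symm]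
    · refine ⟨listing (fun z => z = a) ++ listing (fun z => c z = 0 ∧ z ≠ a) ++
        listing (fun z => c z = 1) ++ listing (fun z => c z = 2 ∧ z ≠ b) ++
        listing (fun z => z = a) ++ listing (fun z => z = b) ++
        listing (fun z => c z = 0 ∧ z ≠ a) ++ listing (fun z => c z = 1) ++
        listing (fun z => z = b) ++ listing (fun z => c z = 2 ∧ z ≠ b), ?_, ?_⟩
      · intro u v huv hlt
        refine ⟨2, ?_⟩
        rcases lt3 _ _ hlt with ⟨hu, hv⟩ | ⟨hu, hv⟩ | ⟨hu, hv⟩ <;>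
          by_cases hua : u = a <;> by_cases hub : u = b <;>
          by_cases hva : v = a <;> by_cases hvb : v = b <;>
          simp_all [filter_listing, List.replicate]
      · simp [alternate_iff_isChain, filter_listing, ha, hb, hne, hne.symm]
    · refine ⟨_, hbase.append (w' := listing (fun z => c z = 0) ++
        listing (fun z => c z = 1 ∧ z ≠ a) ++ listing (fun z => z = b) ++
        listing (fun z => z = a) ++ listing (fun z => c z = 2 ∧ z ≠ b)) ?_, ?_⟩
      · intro u v huv hlt
        refine ⟨1, ?_⟩
        rcases lt3 _ _ hlt with ⟨hu, hv⟩ | ⟨hu, hv⟩ | ⟨hu, hv⟩ <;>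
          by_cases hua : u = a <;> by_cases hub : u = b <;>
          by_cases hva : v = a <;> by_cases hvb : v = b <;>
          simp_all [filter_listing, List.replicate]
      · simp [alternate_iff_isChain, filter_listing, ha, hb, hne, hne.symm]
  intro a b hab hadj
  rcases lt_trichotomy (c a) (c b) with h | h | h
  · exact hsep a b h hadj
  · refine ⟨listing (fun z => c z = 0 ∧ z = a) ++ listing (fun z => c z = 0 ∧ z ≠ a) ++
      listing (fun z => c z = 1 ∧ z = a) ++ listing (fun z => c z = 1 ∧ z ≠ a) ++
      listing (fun z => c z = 2 ∧ z = a) ++ listing (fun z => c z = 2 ∧ z ≠ a) ++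
      listing (fun z => c z = 0 ∧ z ≠ a) ++ listing (fun z => c z = 0 ∧ z = a) ++
      listing (fun z => c z = 1 ∧ z ≠ a) ++ listing (fun z => c z = 1 ∧ z = a) ++
      listing (fun z => c z = 2 ∧ z ≠ a) ++ listing (fun z => c z = 2 ∧ z = a), ?_, ?_⟩
    · intro u v huv hlt
      refine ⟨2, ?_⟩
      rcases lt3 _ _ hlt with ⟨hu, hv⟩ | ⟨hu, hv⟩ | ⟨hu, hv⟩ <;>
        by_cases hua : u = a <;> by_cases hva : v = a <;>
        simp_all [filter_listing, List.replicate]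
    · rcases fin3 (c a) with ha | ha | ha <;>
        simp [alternate_iff_isChain, filter_listing, ha, h ▸ ha, hab.symm]
  · obtain ⟨w, hw, hn⟩ := hsep b a h fun h' => hadj h'.symm
    exact ⟨w, hw, fun h' => hn h'.symm⟩

end ThreeColorable

theorem stmt4 (n x : ℕ) (hn : 3 ≤ n) (hx1 : 1 < x) (hxn : x < n)
    (h0 : n % 3 = 1) (h1 : x % 3 = 1) :
    WordRepresentable (SimpleGraph.circulantGraph {((1 : ℕ) : ZMod (2*n)), ((x : ℕ) : ZMod (2*n)), ((n : ℕ) : ZMod (2*n))}) := by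
  have : NeZero (2 * n) := ⟨by omega⟩
  have key : ∀ (u v : ZMod (2 * n)) (j : ℕ), j < 2 * n → j % 3 = 1 → u - v = (j : ZMod (2 * n)) →
      u.val % 3 ≠ v.val % 3 := by
    intro u v j hj hj3 h
    have hu : u = v + j := by rw [← h]; ring
    have hval : u.val = (v.val + j) % (2 * n) := by
      rw [hu, ZMod.val_add, ZMod.val_natCast, Nat.mod_eq_of_lt hj]
    have hv := ZMod.val_lt v
    rcases lt_or_ge (v.val + j) (2 * n) with hlt | hge
    · rw [Nat.mod_eq_of_lt hlt] at hval
      omega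
    · rw [Nat.mod_eq_sub_mod hge, Nat.mod_eq_of_lt (by omega)] at hval
      omega
  have key' : ∀ u v : ZMod (2 * n), u - v ∈ ({((1 : ℕ) : ZMod (2*n)), ((x : ℕ) : ZMod (2*n)),
      ((n : ℕ) : ZMod (2*n))} : Set (ZMod (2 * n))) → u.val % 3 ≠ v.val % 3 := by
    rintro u v (h | h | h)
    · exact key u v 1 (by omega) rfl h
    · exact key u v x (by omega) h1 h
    · exact key u v n (by omega) h0 h
  refine wordRepresentable_of_three_coloring _
    (fun v => ⟨v.val % 3, Nat.mod_lt _ (by norm_num)⟩) fun u v huv => ?_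
  rw [ne_eq, Fin.mk.injEq]
  rw [SimpleGraph.circulantGraph_adj] at huv
  rcases huv with ⟨-, h | h⟩
  · exact key' u v h
  · exact (key' v u h).symm
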